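/- There exists C > 0 such that for every f : ℝ → ℂ with ⟨x⟩²f ∈ L¹(ℝ) and every ξ with 0 < |ξ| ≤ 1, one has |f̃(ξ)| ≤ C ξ² ‖⟨x⟩² f‖_{L¹} and |∂_ξ f̃(ξ)| ≤ C |ξ| ‖⟨x⟩² f‖_{L¹}. -/

import Mathlib

noncomputable section

open MeasureTheory Complex Filter

/-- Japanese bracket `⟨x⟩ = (1+x²)^{1/2}`. -/
def jap (x : ℝ) : ℝ := Real.sqrt (1 + x ^ 2)

/-- The operator `g ↦ ⟨x⟩ ∂ₓ g` acting in the first variable. -/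
def DX (F : ℝ → ℝ → ℂ) : ℝ → ℝ → ℂ := fun x ξ => (jap x : ℂ) * deriv (fun y => F y ξ) x

/-- The operator `g ↦ ξ ∂_ξ g` acting in the second variable. -/
def DXI (F : ℝ → ℝ → ℂ) : ℝ → ℝ → ℂ := fun x ξ => (ξ : ℂ) * deriv (fun η => F x η) ξ

/-- Coefficients `a, b` of the distorted Fourier basis together with their
symbol-type bounds (the context hypotheses). -/
structure ABData where
  a : ℝ → ℝ → ℂ
  b : ℝ → ℝ → ℂ
  C : ℕ → ℕ → ℝ
  Cpos : ∀ k l : ℕ, 0 < C k l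
  smooth_a : ContDiffOn ℝ (⊤ : ℕ∞) (fun p : ℝ × ℝ => a p.1 p.2) {p : ℝ × ℝ | p.2 ≠ 0}
  smooth_b : ContDiffOn ℝ (⊤ : ℕ∞) (fun p : ℝ × ℝ => b p.1 p.2) {p : ℝ × ℝ | p.2 ≠ 0}
  symm_a : ∀ x ξ : ℝ, a x (-ξ) = a (-x) ξ
  symm_b : ∀ x ξ : ℝ, b x (-ξ) = b (-x) ξ
  bzero : ∀ x ξ : ℝ, 0 < ξ → -(1 / (2 * ξ)) ≤ x → b x ξ = 0
  bd_a1 : ∀ k l : ℕ, ∀ x ξ : ℝ, 0 < ξ → ξ ≤ 1 → 0 ≤ x →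
    ‖(DX^[k] (DXI^[l] a)) x ξ‖ ≤ C k l * ξ ^ 3 * (1 + ξ⁻¹ * (jap x)⁻¹)
  bd_a2 : ∀ k l : ℕ, ∀ x ξ : ℝ, 0 < ξ → ξ ≤ 1 → -(1 / (2 * ξ)) < x → x < 0 →
    ‖(DX^[k] (DXI^[l] a)) x ξ‖ ≤ C k l * ξ ^ 2 * (jap x) ^ 2
  bd_ab3 : ∀ k l : ℕ, ∀ x ξ : ℝ, 0 < ξ → ξ ≤ 1 → x ≤ -(1 / (2 * ξ)) →
    ‖(DX^[k] (DXI^[l] a)) x ξ‖ + ‖(DX^[k] (DXI^[l] b)) x ξ‖ ≤ C k l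
  bd_a4 : ∀ k l : ℕ, ∀ x ξ : ℝ, 1 ≤ ξ →
    ‖(DX^[k] (DXI^[l] (fun x ξ => a x ξ - 1))) x ξ‖ ≤ C k l * ξ⁻¹ * (jap x)⁻¹
  bd_b4 : ∀ k l : ℕ, ∀ x ξ : ℝ, 1 ≤ ξ → ‖(DX^[k] (DXI^[l] b)) x ξ‖ ≤ C k l * ξ⁻¹
  bzero' : ∀ x ξ : ℝ, 1 ≤ ξ → 0 < x → b x ξ = 0

/-- The distorted Fourier basis `e(x,ξ) = e^{ixξ} a(x,ξ) + e^{−ixξ} b(x,ξ)`. -/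
def eBasis (D : ABData) (x ξ : ℝ) : ℂ :=
  Complex.exp (Complex.I * x * ξ) * D.a x ξ + Complex.exp (-(Complex.I) * x * ξ) * D.b x ξ

/-- The distorted Fourier transform `f̃(ξ) = ∫ f(x) conj(e(x,ξ)) dx`. -/
def dFT (D : ABData) (f : ℝ → ℂ) (ξ : ℝ) : ℂ :=
  ∫ x : ℝ, f x * (starRingEnd ℂ) (eBasis D x ξ)

lemma one_le_jap (x : ℝ) : 1 ≤ jap x :=
  Real.one_le_sqrt.mpr (by nlinarith [sq_nonneg x])

lemma jap_sq (x : ℝ) : jap x ^ 2 = 1 + x ^ 2 :=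
  Real.sq_sqrt (by positivity)

/-- All the derivatives `(ξ∂_ξ)^l b` vanish in the region where `b` does. -/
lemma iterate_DXI_b_eq_zero (D : ABData) (l : ℕ) :
    ∀ x ξ : ℝ, 0 < ξ → -(1 / (2 * ξ)) < x → (DXI^[l] D.b) x ξ = 0 := by
  induction l with
  | zero => exact fun x ξ hξ hx => D.bzero x ξ hξ hx.le
  | succ l ih =>
    intro x ξ hξ hx
    have hcont : ContinuousAt (fun η : ℝ => -(1 / (2 * η))) ξ := by
      have : 2 * ξ ≠ 0 := by positivity
      fun_prop (disch := assumption)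
    have hev : (fun η => (DXI^[l] D.b) x η) =ᶠ[nhds ξ] fun _ => 0 := by
      filter_upwards [lt_mem_nhds hξ, hcont.eventually (gt_mem_nhds hx)] with η h1 h2
      exact ih x η h1 h2
    rw [Function.iterate_succ_apply', DXI, hev.deriv_eq]
    simp

/-- The coefficients, and their derivatives `(ξ∂_ξ)^l`, are `O(ξ²⟨x⟩²)`; with an additional
factor `|x|` they are `O(ξ⟨x⟩²)`. -/
lemma norm_iterate_DXI_add_le (D : ABData) (l : ℕ) {x ξ : ℝ} (hξ : 0 < ξ) (hξ1 : ξ ≤ 1) :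
    ‖(DXI^[l] D.a) x ξ‖ + ‖(DXI^[l] D.b) x ξ‖ ≤ 4 * D.C 0 l * ξ ^ 2 * (1 + x ^ 2) ∧
    |x| * (‖(DXI^[l] D.a) x ξ‖ + ‖(DXI^[l] D.b) x ξ‖) ≤ 4 * D.C 0 l * ξ * (1 + x ^ 2) := by
  have hC := D.Cpos 0 l
  have hinv : ξ * (1 / (2 * ξ)) = 1 / 2 := by field_simp
  have hipos : 0 < 1 / (2 * ξ) := by positivity
  rcases le_or_gt x (-(1 / (2 * ξ))) with hx | hx
  · have h : ‖(DXI^[l] D.a) x ξ‖ + ‖(DXI^[l] D.b) x ξ‖ ≤ D.C 0 l := D.bd_ab3 0 l x ξ hξ hξ1 hx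
    have hx' : 1 ≤ 2 * ξ * |x| := by
      rw [abs_of_neg (by linarith)]; nlinarith
    have hx2 : 1 ≤ 4 * ξ ^ 2 * x ^ 2 := by rw [← sq_abs x]; nlinarith
    constructor
    · calc _ ≤ D.C 0 l * 1 := by linarith
        _ ≤ D.C 0 l * (4 * ξ ^ 2 * (1 + x ^ 2)) := by gcongr; nlinarith [sq_nonneg ξ]
        _ = _ := by ring
    · calc _ ≤ |x| * D.C 0 l := by gcongr
        _ = D.C 0 l * (|x| * 1) := by ring
        _ ≤ D.C 0 l * (|x| * (2 * ξ * |x|)) := by gcongr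
        _ = D.C 0 l * (2 * ξ * x ^ 2) := by rw [← sq_abs x]; ring
        _ ≤ D.C 0 l * (4 * ξ * (1 + x ^ 2)) := by gcongr ?_ * ?_; nlinarith [sq_nonneg x]
        _ = _ := by ring
  rw [iterate_DXI_b_eq_zero D l x ξ hξ hx, norm_zero, add_zero]
  rcases lt_or_ge x 0 with hx0 | hx0
  · have h : ‖(DXI^[l] D.a) x ξ‖ ≤ D.C 0 l * ξ ^ 2 * jap x ^ 2 := D.bd_a2 0 l x ξ hξ hξ1 hx hx0
    rw [jap_sq] at h
    have hx' : |x| * ξ ≤ 1 := by rw [abs_of_neg hx0]; nlinarith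
    have hp : 0 ≤ D.C 0 l * ξ * (1 + x ^ 2) := by positivity
    constructor
    · nlinarith
    · calc _ ≤ |x| * (D.C 0 l * ξ ^ 2 * (1 + x ^ 2)) := by gcongr
        _ = |x| * ξ * (D.C 0 l * ξ * (1 + x ^ 2)) := by ring
        _ ≤ 1 * (D.C 0 l * ξ * (1 + x ^ 2)) := by gcongr
        _ ≤ _ := by linarith
  · have h : ‖(DXI^[l] D.a) x ξ‖ ≤ D.C 0 l * ξ ^ 3 * (1 + ξ⁻¹ * (jap x)⁻¹) :=
      D.bd_a1 0 l x ξ hξ hξ1 hx0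
    have hj := one_le_jap x
    have hxj : x ≤ jap x := Real.le_sqrt_of_sq_le (by linarith)
    have hxj' : x * (jap x)⁻¹ ≤ 1 := by
      rw [← div_eq_mul_inv]; exact div_le_one_of_le₀ hxj (by linarith)
    have hji : (jap x)⁻¹ ≤ 1 := inv_le_one_of_one_le₀ hj
    have heq : D.C 0 l * ξ ^ 3 * (1 + ξ⁻¹ * (jap x)⁻¹)
        = D.C 0 l * (ξ ^ 2 * (ξ + (jap x)⁻¹)) := by field_simp
    rw [heq] at h
    constructor
    · calc _ ≤ D.C 0 l * (ξ ^ 2 * (ξ + (jap x)⁻¹)) := h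
        _ ≤ D.C 0 l * (ξ ^ 2 * (4 * (1 + x ^ 2))) := by gcongr; nlinarith [sq_nonneg x]
        _ = _ := by ring
    · rw [abs_of_nonneg hx0]
      calc _ ≤ x * (D.C 0 l * (ξ ^ 2 * (ξ + (jap x)⁻¹))) := by gcongr
        _ = D.C 0 l * (ξ * (ξ * (ξ * x + x * (jap x)⁻¹))) := by ring
        _ ≤ D.C 0 l * (ξ * (1 * (1 * x + 1))) := by gcongr
        _ ≤ D.C 0 l * (ξ * (4 * (1 + x ^ 2))) := by gcongr ?_ * (_ * ?_); nlinarith [sq_nonneg (x - 1)]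
        _ = _ := by ring

lemma norm_exp_I_mul (x ξ : ℝ) : ‖Complex.exp (Complex.I * x * ξ)‖ = 1 := by
  simp [Complex.norm_exp]

lemma norm_exp_neg_I_mul (x ξ : ℝ) : ‖Complex.exp (-Complex.I * x * ξ)‖ = 1 := by
  simp [Complex.norm_exp]

lemma norm_eBasis_le (D : ABData) {x ξ : ℝ} (hξ : 0 < ξ) (hξ1 : ξ ≤ 1) :
    ‖eBasis D x ξ‖ ≤ 4 * D.C 0 0 * ξ ^ 2 * (1 + x ^ 2) := by
  refine le_trans ?_ (norm_iterate_DXI_add_le D 0 hξ hξ1).1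
  refine (norm_add_le _ _).trans_eq ?_
  rw [norm_mul, norm_mul, norm_exp_I_mul, norm_exp_neg_I_mul, one_mul, one_mul]
  rfl

lemma differentiableAt_snd_of_contDiffOn {g : ℝ → ℝ → ℂ}
    (hg : ContDiffOn ℝ (⊤ : ℕ∞) (fun p : ℝ × ℝ => g p.1 p.2) {p : ℝ × ℝ | p.2 ≠ 0})
    {x ξ : ℝ} (hξ : ξ ≠ 0) : DifferentiableAt ℝ (g x) ξ := by
  have hopen : IsOpen {p : ℝ × ℝ | p.2 ≠ 0} := isOpen_ne_fun continuous_snd continuous_const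
  have h : DifferentiableAt ℝ (fun p : ℝ × ℝ => g p.1 p.2) (x, ξ) :=
    (hg.contDiffAt (hopen.mem_nhds hξ)).differentiableAt (by simp)
  exact h.comp ξ (f := fun η : ℝ => (x, η)) (by fun_prop)

lemma continuous_fst_of_contDiffOn {g : ℝ → ℝ → ℂ}
    (hg : ContDiffOn ℝ (⊤ : ℕ∞) (fun p : ℝ × ℝ => g p.1 p.2) {p : ℝ × ℝ | p.2 ≠ 0})
    {ξ : ℝ} (hξ : ξ ≠ 0) : Continuous fun x => g x ξ :=
  hg.continuousOn.comp_continuous (f := fun x : ℝ => (x, ξ)) (by fun_prop) fun _ => hξ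

lemma continuous_eBasis (D : ABData) {ξ : ℝ} (hξ : ξ ≠ 0) : Continuous fun x => eBasis D x ξ := by
  have ha := continuous_fst_of_contDiffOn D.smooth_a hξ
  have hb := continuous_fst_of_contDiffOn D.smooth_b hξ
  unfold eBasis
  fun_prop

lemma hasDerivAt_eBasis (D : ABData) {x ξ : ℝ} (hξ : ξ ≠ 0) :
    HasDerivAt (eBasis D x)
      (Complex.exp (Complex.I * x * ξ) * (Complex.I * x * D.a x ξ + deriv (D.a x) ξ) +
        Complex.exp (-Complex.I * x * ξ) * (-Complex.I * x * D.b x ξ + deriv (D.b x) ξ)) ξ := by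
  have hexp : ∀ c : ℂ, HasDerivAt (fun η : ℝ => Complex.exp (c * η)) (Complex.exp (c * ξ) * c) ξ :=
    fun c => by simpa using ((Complex.ofRealCLM.hasDerivAt (x := ξ)).const_mul c).cexp
  have ha := (differentiableAt_snd_of_contDiffOn D.smooth_a (x := x) hξ).hasDerivAt
  have hb := (differentiableAt_snd_of_contDiffOn D.smooth_b (x := x) hξ).hasDerivAt
  refine (((hexp (Complex.I * x)).mul ha).add ((hexp (-Complex.I * x)).mul hb)).congr_deriv ?_
  ring

lemma norm_deriv_eBasis_le (D : ABData) {x ξ : ℝ} (hξ : 0 < ξ) (hξ1 : ξ ≤ 1) :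
    ‖deriv (eBasis D x) ξ‖ ≤ 4 * (D.C 0 0 + D.C 0 1) * ξ * (1 + x ^ 2) := by
  have h0 := (norm_iterate_DXI_add_le D 0 (x := x) hξ hξ1).2
  have h1 := (norm_iterate_DXI_add_le D 1 (x := x) hξ hξ1).1
  simp only [Function.iterate_zero, id, Function.iterate_one, DXI, norm_mul, Complex.norm_real,
    Real.norm_of_nonneg hξ.le] at h0 h1
  have h1' : ‖deriv (D.a x) ξ‖ + ‖deriv (D.b x) ξ‖ ≤ 4 * D.C 0 1 * ξ * (1 + x ^ 2) := by
    refine le_of_mul_le_mul_left ?_ hξ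
    calc _ = _ := mul_add _ _ _
      _ ≤ _ := h1
      _ = _ := by ring
  rw [(hasDerivAt_eBasis D hξ.ne').deriv]
  calc _ ≤ (|x| * ‖D.a x ξ‖ + ‖deriv (D.a x) ξ‖) + (|x| * ‖D.b x ξ‖ + ‖deriv (D.b x) ξ‖) := by
        refine (norm_add_le _ _).trans ?_
        rw [norm_mul, norm_mul, norm_exp_I_mul, norm_exp_neg_I_mul, one_mul, one_mul]
        gcongr <;> exact (norm_add_le _ _).trans_eq (by simp)
    _ ≤ _ := by linarith

lemma norm_eBasis_sub_le (D : ABData) {x ξ η : ℝ} (hη : 0 < η) (hηξ : η ≤ ξ) (hξ1 : ξ ≤ 1) :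
    ‖eBasis D x η - eBasis D x ξ‖
      ≤ 4 * (D.C 0 0 + D.C 0 1) * ξ * (1 + x ^ 2) * ‖η - ξ‖ := by
  have hC := D.Cpos 0 0
  have hC' := D.Cpos 0 1
  refine (convex_Icc η ξ).norm_image_sub_le_of_norm_deriv_le (f := eBasis D x) (fun t ht => ?_)
    (fun t ht => ?_) (Set.right_mem_Icc.mpr hηξ) (Set.left_mem_Icc.mpr hηξ)
  · exact (hasDerivAt_eBasis D (hη.trans_le ht.1).ne').differentiableAt
  · refine (norm_deriv_eBasis_le D (hη.trans_le ht.1) (ht.2.trans hξ1)).trans ?_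
    gcongr
    exact ht.2

lemma aestronglyMeasurable_of_integrable_one_add_sq_mul {f : ℝ → ℂ}
    (hf : Integrable fun x : ℝ => ((1 + x ^ 2 : ℝ) : ℂ) * f x) : AEStronglyMeasurable f := by
  have hc : Continuous fun x : ℝ => (((1 + x ^ 2)⁻¹ : ℝ) : ℂ) := by
    have : ∀ x : ℝ, 1 + x ^ 2 ≠ 0 := fun x => by positivity
    fun_prop (disch := assumption)
  refine (hc.aestronglyMeasurable.mul hf.1).congr (Eventually.of_forall fun x => ?_)
  have : ((1 + x ^ 2 : ℝ) : ℂ) ≠ 0 := Complex.ofReal_ne_zero.mpr (by positivity)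
  simp only [Pi.mul_apply, Complex.ofReal_inv]
  field_simp

lemma integrable_one_add_sq_mul_norm {f : ℝ → ℂ}
    (hf : Integrable fun x : ℝ => ((1 + x ^ 2 : ℝ) : ℂ) * f x) :
    Integrable fun x : ℝ => (1 + x ^ 2) * ‖f x‖ := by
  refine hf.norm.congr (Eventually.of_forall fun x => ?_)
  simp only [norm_mul, Complex.norm_real]
  rw [Real.norm_of_nonneg (by positivity)]

lemma norm_integral_mul_le_of_norm_le_one_add_sq {f g : ℝ → ℂ} {K : ℝ}
    (hf : Integrable fun x : ℝ => ((1 + x ^ 2 : ℝ) : ℂ) * f x)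
    (hg : ∀ x, ‖g x‖ ≤ K * (1 + x ^ 2)) :
    ‖∫ x, f x * g x‖ ≤ K * ∫ x : ℝ, (1 + x ^ 2) * ‖f x‖ := by
  rw [← integral_const_mul]
  refine norm_integral_le_of_norm_le ((integrable_one_add_sq_mul_norm hf).const_mul K)
    (Eventually.of_forall fun x => ?_)
  rw [norm_mul]
  calc _ ≤ ‖f x‖ * (K * (1 + x ^ 2)) := by gcongr; exact hg x
    _ = _ := by ring

lemma integrable_mul_conj_eBasis (D : ABData) {f : ℝ → ℂ}
    (hf : Integrable fun x : ℝ => ((1 + x ^ 2 : ℝ) : ℂ) * f x) {ξ : ℝ} (hξ : 0 < ξ) (hξ1 : ξ ≤ 1) :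
    Integrable fun x => f x * (starRingEnd ℂ) (eBasis D x ξ) := by
  refine ((integrable_one_add_sq_mul_norm hf).const_mul (4 * D.C 0 0 * ξ ^ 2)).mono'
    ((aestronglyMeasurable_of_integrable_one_add_sq_mul hf).mul
      (Complex.continuous_conj.comp (continuous_eBasis D hξ.ne')).aestronglyMeasurable)
    (Eventually.of_forall fun x => ?_)
  rw [norm_mul, RCLike.norm_conj]
  calc _ ≤ ‖f x‖ * (4 * D.C 0 0 * ξ ^ 2 * (1 + x ^ 2)) := by gcongr; exact norm_eBasis_le D hξ hξ1
    _ = _ := by ring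

lemma norm_dFT_le (D : ABData) {f : ℝ → ℂ}
    (hf : Integrable fun x : ℝ => ((1 + x ^ 2 : ℝ) : ℂ) * f x) {ξ : ℝ} (hξ : 0 < ξ) (hξ1 : ξ ≤ 1) :
    ‖dFT D f ξ‖ ≤ 4 * D.C 0 0 * ξ ^ 2 * ∫ x : ℝ, (1 + x ^ 2) * ‖f x‖ :=
  norm_integral_mul_le_of_norm_le_one_add_sq hf fun x => by
    rw [RCLike.norm_conj]; exact norm_eBasis_le D hξ hξ1

lemma norm_dFT_sub_le (D : ABData) {f : ℝ → ℂ}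
    (hf : Integrable fun x : ℝ => ((1 + x ^ 2 : ℝ) : ℂ) * f x) {ξ η : ℝ} (hη : 0 < η)
    (hηξ : η ≤ ξ) (hξ1 : ξ ≤ 1) :
    ‖dFT D f η - dFT D f ξ‖
      ≤ 4 * (D.C 0 0 + D.C 0 1) * ξ * ‖η - ξ‖ * ∫ x : ℝ, (1 + x ^ 2) * ‖f x‖ := by
  unfold dFT
  rw [← integral_sub (integrable_mul_conj_eBasis D hf hη (hηξ.trans hξ1))
    (integrable_mul_conj_eBasis D hf (hη.trans_le hηξ) hξ1)]
  simp_rw [← mul_sub, ← map_sub]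
  refine norm_integral_mul_le_of_norm_le_one_add_sq hf fun x => ?_
  rw [RCLike.norm_conj]
  exact (norm_eBasis_sub_le D hη hηξ hξ1).trans_eq (by ring)

lemma norm_deriv_le_of_eventually_left {g : ℝ → ℂ} {ξ K : ℝ} (hK : 0 ≤ K)
    (h : ∀ᶠ η in nhdsWithin ξ (Set.Iio ξ), ‖g η - g ξ‖ ≤ K * ‖η - ξ‖) : ‖deriv g ξ‖ ≤ K := by
  by_cases hd : DifferentiableAt ℝ g ξ
  · have ht := (hasDerivAt_iff_tendsto_slope.mp hd.hasDerivAt).mono_left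
      (nhdsWithin_mono ξ fun η (hη : η ∈ Set.Iio ξ) => ne_of_lt hη)
    refine le_of_tendsto ht.norm ?_
    filter_upwards [h, self_mem_nhdsWithin] with η h1 h2
    have hpos : 0 < ‖η - ξ‖ := norm_pos_iff.mpr (sub_ne_zero.mpr (ne_of_lt h2))
    rw [slope_def_module, norm_smul, norm_inv, inv_mul_le_iff₀ hpos, mul_comm]
    exact h1
  · simpa [deriv_zero_of_not_differentiableAt hd] using hK

lemma norm_deriv_dFT_le (D : ABData) {f : ℝ → ℂ}
    (hf : Integrable fun x : ℝ => ((1 + x ^ 2 : ℝ) : ℂ) * f x) {ξ : ℝ} (hξ : 0 < ξ) (hξ1 : ξ ≤ 1) :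
    ‖deriv (dFT D f) ξ‖
      ≤ 4 * (D.C 0 0 + D.C 0 1) * ξ * ∫ x : ℝ, (1 + x ^ 2) * ‖f x‖ := by
  have hC := D.Cpos 0 0
  have hC' := D.Cpos 0 1
  have hI : 0 ≤ ∫ x : ℝ, (1 + x ^ 2) * ‖f x‖ := integral_nonneg fun x => by positivity
  refine norm_deriv_le_of_eventually_left (by positivity) ?_
  filter_upwards [self_mem_nhdsWithin, mem_nhdsWithin_of_mem_nhds (lt_mem_nhds hξ)] with η h1 h2
  exact (norm_dFT_sub_le D hf h2 (le_of_lt h1) hξ1).trans_eq (by ring)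

lemma eBasis_neg (D : ABData) (x ξ : ℝ) : eBasis D x (-ξ) = eBasis D (-x) ξ := by
  simp [eBasis, D.symm_a, D.symm_b]

lemma dFT_neg (D : ABData) (f : ℝ → ℂ) (ξ : ℝ) :
    dFT D f (-ξ) = dFT D (fun x => f (-x)) ξ := by
  unfold dFT
  rw [← integral_neg_eq_self]
  simp [eBasis_neg]

lemma deriv_dFT_neg (D : ABData) (f : ℝ → ℂ) (ξ : ℝ) :
    deriv (dFT D f) (-ξ) = -deriv (dFT D fun x => f (-x)) ξ := by
  rw [← funext (dFT_neg D f), deriv_comp_neg, neg_neg]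

/-- quadratic vanishing of the distorted Fourier transform at `ξ = 0`:
`|f̃(ξ)| ≤ C ξ² ‖⟨x⟩²f‖_{L¹}` and `|∂_ξ f̃(ξ)| ≤ C |ξ| ‖⟨x⟩²f‖_{L¹}` for `0 < |ξ| ≤ 1`. -/
theorem dFT_vanishing_at_zero (D : ABData) :
    ∃ C : ℝ, 0 < C ∧
      ∀ f : ℝ → ℂ, Integrable (fun x : ℝ => ((1 + x ^ 2 : ℝ) : ℂ) * f x) →
        ∀ ξ : ℝ, ξ ≠ 0 → |ξ| ≤ 1 →
          ‖dFT D f ξ‖ ≤ C * ξ ^ 2 * ∫ x : ℝ, (1 + x ^ 2) * ‖f x‖ ∧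
          ‖deriv (dFT D f) ξ‖ ≤ C * |ξ| * ∫ x : ℝ, (1 + x ^ 2) * ‖f x‖ := by
  have hC := D.Cpos 0 0
  have hC' := D.Cpos 0 1
  have key : ∀ f : ℝ → ℂ, Integrable (fun x : ℝ => ((1 + x ^ 2 : ℝ) : ℂ) * f x) →
      ∀ ξ : ℝ, 0 < ξ → ξ ≤ 1 →
        ‖dFT D f ξ‖ ≤ 4 * (D.C 0 0 + D.C 0 1) * ξ ^ 2 * ∫ x : ℝ, (1 + x ^ 2) * ‖f x‖ ∧
        ‖deriv (dFT D f) ξ‖ ≤ 4 * (D.C 0 0 + D.C 0 1) * ξ * ∫ x : ℝ, (1 + x ^ 2) * ‖f x‖ := by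
    intro f hf ξ hξ hξ1
    have hI : 0 ≤ ∫ x : ℝ, (1 + x ^ 2) * ‖f x‖ := integral_nonneg fun x => by positivity
    refine ⟨(norm_dFT_le D hf hξ hξ1).trans ?_, norm_deriv_dFT_le D hf hξ hξ1⟩
    gcongr
    linarith
  refine ⟨4 * (D.C 0 0 + D.C 0 1), by positivity, fun f hf ξ hξ hξ1 => ?_⟩
  rcases lt_or_gt_of_ne hξ with hneg | hpos
  · rw [abs_of_neg hneg] at hξ1 ⊢
    have hf' : Integrable fun x : ℝ => ((1 + x ^ 2 : ℝ) : ℂ) * f (-x) := by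
      simpa using hf.comp_neg
    have h := key (fun x => f (-x)) hf' (-ξ) (neg_pos.mpr hneg) hξ1
    have hint : ∫ x : ℝ, (1 + x ^ 2) * ‖f (-x)‖ = ∫ x : ℝ, (1 + x ^ 2) * ‖f x‖ := by
      rw [← integral_neg_eq_self fun x : ℝ => (1 + x ^ 2) * ‖f x‖]
      simp_rw [neg_sq]
    rwa [← dFT_neg, ← norm_neg (deriv _ _), ← deriv_dFT_neg, neg_neg, neg_sq, hint] at h
  · rw [abs_of_pos hpos] at hξ1 ⊢
    exact key f hf ξ hpos hξ1
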